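/- arXiv:2303.01624 — 2 statements merged into one kernel-verified Lean document; each statement's English description precedes it below -/
import Mathlib

section
/- Let W ∈ S^d be positive semidefinite and let v ∈ ℝ^d lie in the column space (range) of W. Then there exists ε > 0 such that W − ε v vᵀ is positive semidefinite. -/
open Matrix

noncomputable section

/-- Lemma (Burer et al.): if `W ⪰ 0` and `v` lies in the range of `W`, then
`W - ε v vᵀ ⪰ 0` for some `ε > 0`. -/
theorem psd_sub_rankOne_of_mem_range {d : ℕ}
    (W : Matrix (Fin d) (Fin d) ℝ) (hW : W.PosSemidef)
    (v : Fin d → ℝ) (hv : ∃ u : Fin d → ℝ, W *ᵥ u = v) :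
    ∃ ε : ℝ, 0 < ε ∧ (W - ε • vecMulVec v v).PosSemidef := by
  obtain ⟨u, rfl⟩ := hv
  rw [posSemidef_iff_dotProduct_mulVec] at hW
  obtain ⟨hH, hnn⟩ := hW
  simp only [star_trivial] at hnn
  set c := u ⬝ᵥ (W *ᵥ u) with hc
  have hc0 : 0 ≤ c := hnn u
  have hε : 0 < (1 + c)⁻¹ := by positivity
  refine ⟨(1 + c)⁻¹, hε, posSemidef_iff_dotProduct_mulVec.2 ⟨hH.sub ?_, fun x => ?_⟩⟩
  · ext i j
    simp [vecMulVec_apply, mul_comm]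
  have hsymm : u ⬝ᵥ (W *ᵥ x) = x ⬝ᵥ (W *ᵥ u) := by
    have hT : Wᵀ = W := by simpa [IsHermitian, conjTranspose_eq_transpose_of_trivial] using hH
    rw [dotProduct_mulVec, ← mulVec_transpose, hT, dotProduct_comm]
  set ε := (1 + c)⁻¹ with hεdef
  set b := x ⬝ᵥ (W *ᵥ u) with hb
  have hεc : ε * c ≤ 1 := by
    have h : ε * (1 + c) = 1 := inv_mul_cancel₀ (by positivity)
    linarith
  have key := hnn (x - (ε * b) • u)
  simp only [mulVec_sub, mulVec_smul, sub_dotProduct, dotProduct_sub, smul_dotProduct,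
    dotProduct_smul, smul_eq_mul, hsymm, ← hb, ← hc] at key
  have hval : star x ⬝ᵥ ((W - ε • vecMulVec (W *ᵥ u) (W *ᵥ u)) *ᵥ x)
      = x ⬝ᵥ (W *ᵥ x) - ε * b ^ 2 := by
    simp only [star_trivial, sub_mulVec, smul_mulVec, dotProduct_sub, dotProduct_smul,
      vecMulVec_mulVec, op_smul_eq_smul, smul_eq_mul, dotProduct_comm (W *ᵥ u) x, ← hb]
    ring
  rw [hval]
  have hbound : ε * c * (ε * b ^ 2) ≤ 1 * (ε * b ^ 2) := by gcongr
  linarith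

end
end

section
/- Let W ∈ S^d be positive semidefinite with rank(W) = 2, and let ℓ₁, ℓ₂ ∈ ℝ^d. Set v₁ := Wℓ₁ and v₂ := Wℓ₂, and suppose ℓ₁ᵀv₁ > 0, ℓ₂ᵀv₂ > 0, and ℓ₁ᵀWℓ₂ = 0. Then W = (ℓ₁ᵀv₁)⁻¹ v₁v₁ᵀ + (ℓ₂ᵀv₂)⁻¹ v₂v₂ᵀ. -/
open Matrix

noncomputable section

/-- A symmetric matrix is self-adjoint for the dot product. -/
theorem dotProduct_mulVec_comm_of_isSymm {n R : Type*} [Fintype n] [CommSemiring R]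
    {W : Matrix n n R} (hW : W.IsSymm) (x y : n → R) :
    x ⬝ᵥ (W *ᵥ y) = (W *ᵥ x) ⬝ᵥ y := by
  rw [dotProduct_mulVec, ← mulVec_transpose, hW.eq]

/-- Two linearly independent vectors in the column space of a rank-two matrix span it. -/
theorem span_pair_eq_range_mulVecLin {m n K : Type*} [Fintype m] [Fintype n] [Field K]
    {W : Matrix m n K} (hrank : W.rank = 2) {x y : n → K}
    (hli : LinearIndependent K ![W *ᵥ x, W *ᵥ y]) :
    Submodule.span K {W *ᵥ x, W *ᵥ y} = LinearMap.range W.mulVecLin := by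
  apply Submodule.eq_of_le_of_finrank_eq
  · rw [Submodule.span_le, Set.insert_subset_iff, Set.singleton_subset_iff]
    exact ⟨⟨x, rfl⟩, ⟨y, rfl⟩⟩
  · have h := finrank_span_eq_card hli
    rw [range_cons_cons_empty, Fintype.card_fin] at h
    exact h.trans hrank.symm

/-- Rank-two decomposition: if `W ⪰ 0` has rank 2, `v₁ = Wℓ₁`, `v₂ = Wℓ₂`,
`ℓ₁ᵀv₁ > 0`, `ℓ₂ᵀv₂ > 0`, and `ℓ₁ᵀWℓ₂ = 0`, then
`W = (ℓ₁ᵀv₁)⁻¹ v₁v₁ᵀ + (ℓ₂ᵀv₂)⁻¹ v₂v₂ᵀ`. -/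
theorem rank_two_decomposition {d : ℕ}
    (W : Matrix (Fin d) (Fin d) ℝ) (hW : W.PosSemidef) (hrank : W.rank = 2)
    (l1 l2 : Fin d → ℝ)
    (h1 : 0 < l1 ⬝ᵥ (W *ᵥ l1)) (h2 : 0 < l2 ⬝ᵥ (W *ᵥ l2))
    (h12 : l1 ⬝ᵥ (W *ᵥ l2) = 0) :
    W = (l1 ⬝ᵥ (W *ᵥ l1))⁻¹ • vecMulVec (W *ᵥ l1) (W *ᵥ l1) +
        (l2 ⬝ᵥ (W *ᵥ l2))⁻¹ • vecMulVec (W *ᵥ l2) (W *ᵥ l2) := by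
  have hsymm : W.IsSymm := by
    simpa [IsHermitian, IsSymm, conjTranspose_eq_transpose_of_trivial] using hW.isHermitian
  have h21 : l2 ⬝ᵥ (W *ᵥ l1) = 0 := by
    rw [dotProduct_mulVec_comm_of_isSymm hsymm, dotProduct_comm, h12]
  have hli : LinearIndependent ℝ ![W *ᵥ l1, W *ᵥ l2] := by
    refine LinearIndependent.pair_iff.2 fun a b hab => ⟨?_, ?_⟩
    · simpa [h12, h1.ne'] using congrArg (l1 ⬝ᵥ ·) hab
    · simpa [h21, h2.ne'] using congrArg (l2 ⬝ᵥ ·) hab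
  refine ext_of_mulVec_single fun i => ?_
  generalize (Pi.single i 1 : Fin d → ℝ) = x
  have hx : W *ᵥ x ∈ Submodule.span ℝ {W *ᵥ l1, W *ᵥ l2} := by
    rw [span_pair_eq_range_mulVecLin hrank hli]
    exact ⟨x, rfl⟩
  obtain ⟨a, b, hab⟩ := Submodule.mem_span_pair.1 hx
  have ha : a * (l1 ⬝ᵥ (W *ᵥ l1)) = (W *ᵥ l1) ⬝ᵥ x := by
    rw [← dotProduct_mulVec_comm_of_isSymm hsymm, ← hab]
    simp [h12]
  have hb : b * (l2 ⬝ᵥ (W *ᵥ l2)) = (W *ᵥ l2) ⬝ᵥ x := by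
    rw [← dotProduct_mulVec_comm_of_isSymm hsymm, ← hab]
    simp [h21]
  rw [add_mulVec, smul_mulVec, smul_mulVec, vecMulVec_mulVec, vecMulVec_mulVec, ← ha, ← hb, ← hab]
  simp only [op_smul_eq_smul, smul_smul]
  congr 2 <;> field_simp

end
end
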